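/- arXiv:2603.08311 — 16 statements merged into one kernel-verified Lean document; each statement's English description precedes it below -/
import Mathlib

section
/- Let d ≥ 1, let E be a set of matrix positions (pairs (i,j) with 1 ≤ i,j ≤ d), let e ∈ E, and let Σ be a symmetric positive definite real d×d matrix. Suppose there exist real d×d matrices A⁺, D⁺ with D⁺ diagonal with strictly positive diagonal entries, A⁺Σ + Σ(A⁺)ᵀ = −D⁺, supp(A⁺) = E and the entry of A⁺ at position e strictly positive; and suppose there exist A⁰, D⁰ with D⁰ diagonal with strictly positive diagonal entries, A⁰Σ + Σ(A⁰)ᵀ = −D⁰, supp(A⁰) ⊆ E, and the entry of A⁰ at position e equal to 0. Then there exist real d×d matrices A⁻, D⁻ such that D⁻ is diagonal with strictly positive diagonal entries, A⁻Σ + Σ(A⁻)ᵀ = −D⁻, supp(A⁻) = E, and the entry of A⁻ at position e is strictly negative. -/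
open Matrix

/-- `D` is a diagonal matrix with strictly positive diagonal entries. -/
def IsDiagPos {d : ℕ} (D : Matrix (Fin d) (Fin d) ℝ) : Prop :=
  (∀ i, 0 < D i i) ∧ ∀ i j, i ≠ j → D i j = 0

open Filter Topology

theorem tendsto_sub_mul_nhdsGT_zero (a b : ℝ) :
    Tendsto (fun t : ℝ => a - t * b) (𝓝[>] 0) (𝓝 a) := by
  have h : Continuous fun t : ℝ => a - t * b := by fun_prop
  simpa using (h.tendsto 0).mono_left nhdsWithin_le_nhds

theorem eventually_sub_mul_ne_zero (a : ℝ) {b : ℝ} (hb : b ≠ 0) :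
    ∀ᶠ t : ℝ in 𝓝[>] 0, a - t * b ≠ 0 := by
  by_cases ha : a = 0
  · filter_upwards [self_mem_nhdsWithin] with t ht
    simp [ha, hb, (Set.mem_Ioi.mp ht).ne']
  · exact (tendsto_sub_mul_nhdsGT_zero a b).eventually_ne ha

theorem stmt_1 (d : ℕ) (hd : 1 ≤ d) (E : Set (Fin d × Fin d)) (e : Fin d × Fin d)
    (he : e ∈ E) (S : Matrix (Fin d) (Fin d) ℝ) (hS : S.PosDef)
    (hplus : ∃ A D : Matrix (Fin d) (Fin d) ℝ, IsDiagPos D ∧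
      A * S + S * Aᵀ = -D ∧ (∀ i j, A i j ≠ 0 ↔ (i, j) ∈ E) ∧ 0 < A e.1 e.2)
    (hzero : ∃ A D : Matrix (Fin d) (Fin d) ℝ, IsDiagPos D ∧
      A * S + S * Aᵀ = -D ∧ (∀ i j, (i, j) ∉ E → A i j = 0) ∧ A e.1 e.2 = 0) :
    ∃ A D : Matrix (Fin d) (Fin d) ℝ, IsDiagPos D ∧
      A * S + S * Aᵀ = -D ∧ (∀ i j, A i j ≠ 0 ↔ (i, j) ∈ E) ∧ A e.1 e.2 < 0 := by
  obtain ⟨A, D, hD, hA, hAE, hAe⟩ := hplus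
  obtain ⟨B, F, hF, hB, hBE, hBe⟩ := hzero
  have hpos : ∀ᶠ t : ℝ in 𝓝[>] 0, ∀ i, 0 < F i i - t * D i i :=
    eventually_all.mpr fun i =>
      (tendsto_sub_mul_nhdsGT_zero (F i i) (D i i)).eventually_const_lt (hF.1 i)
  have hsupp : ∀ᶠ t : ℝ in 𝓝[>] 0, ∀ i j, (i, j) ∈ E → B i j - t * A i j ≠ 0 := by
    refine eventually_all.mpr fun i => eventually_all.mpr fun j => ?_
    by_cases hij : (i, j) ∈ E
    · filter_upwards [eventually_sub_mul_ne_zero (B i j) ((hAE i j).mpr hij)] with t ht _ using ht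
    · simp [hij]
  obtain ⟨t, hp, hs, ht⟩ := (hpos.and (hsupp.and self_mem_nhdsWithin)).exists
  refine ⟨B - t • A, F - t • D, ⟨fun i => ?_, fun i j hij => ?_⟩, ?_, fun i j => ⟨?_, ?_⟩, ?_⟩
  · simpa using hp i
  · simp [hF.2 i j hij, hD.2 i j hij]
  · calc (B - t • A) * S + S * (B - t • A)ᵀ
        = (B * S + S * Bᵀ) - t • (A * S + S * Aᵀ) := by
          simp only [transpose_sub, transpose_smul, sub_mul, mul_sub, smul_mul, Matrix.mul_smul,
            smul_add]
          abel
      _ = -(F - t • D) := by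
          rw [hA, hB, smul_neg]
          abel
  · contrapose!
    intro hij
    have hz : A i j = 0 := not_not.mp fun h => hij ((hAE i j).mp h)
    simp [hBE i j hij, hz]
  · intro hij
    simpa using hs i j hij
  · simpa [hBe] using mul_pos (Set.mem_Ioi.mp ht) hAe
end

section
/- Let d ≥ 1, let E be a set of matrix positions (pairs (i,j) with 1 ≤ i,j ≤ d), let e ∈ E, and let Σ be a symmetric positive definite real d×d matrix. Define: P := 'there exist real d×d matrices A, D with D diagonal with strictly positive diagonal entries, AΣ + ΣAᵀ = −D, supp(A) = E, and the entry of A at position e strictly positive'; N := the same with the entry of A at position e strictly negative; Z := 'there exist real d×d matrices A, D with D diagonal with strictly positive diagonal entries, AΣ + ΣAᵀ = −D, supp(A) ⊆ E, and the entry of A at position e equal to 0'. If P or N holds, then Z holds if and only if both P and N hold. -/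
open Matrix

/-- There is a Lyapunov parametrization of `S` with support exactly `E` and
positive weight at `e`. -/
def SignPos {d : ℕ} (E : Set (Fin d × Fin d)) (e : Fin d × Fin d)
    (S : Matrix (Fin d) (Fin d) ℝ) : Prop :=
  ∃ A D : Matrix (Fin d) (Fin d) ℝ, IsDiagPos D ∧
    A * S + S * Aᵀ = -D ∧ (∀ i j, A i j ≠ 0 ↔ (i, j) ∈ E) ∧ 0 < A e.1 e.2

/-- There is a Lyapunov parametrization of `S` with support exactly `E` and
negative weight at `e`. -/
def SignNeg {d : ℕ} (E : Set (Fin d × Fin d)) (e : Fin d × Fin d)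
    (S : Matrix (Fin d) (Fin d) ℝ) : Prop :=
  ∃ A D : Matrix (Fin d) (Fin d) ℝ, IsDiagPos D ∧
    A * S + S * Aᵀ = -D ∧ (∀ i j, A i j ≠ 0 ↔ (i, j) ∈ E) ∧ A e.1 e.2 < 0

/-- There is a Lyapunov parametrization of `S` with support contained in `E` and
zero weight at `e`. -/
def SignZero {d : ℕ} (E : Set (Fin d × Fin d)) (e : Fin d × Fin d)
    (S : Matrix (Fin d) (Fin d) ℝ) : Prop :=
  ∃ A D : Matrix (Fin d) (Fin d) ℝ, IsDiagPos D ∧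
    A * S + S * Aᵀ = -D ∧ (∀ i j, (i, j) ∉ E → A i j = 0) ∧ A e.1 e.2 = 0

/-- Solutions `(A, D)` of the Lyapunov equation for `S` are closed under linear combinations. -/
lemma lyapunov_combination {d : ℕ} {S A₀ D₀ A₁ D₁ : Matrix (Fin d) (Fin d) ℝ}
    (h₀ : A₀ * S + S * A₀ᵀ = -D₀) (h₁ : A₁ * S + S * A₁ᵀ = -D₁) (a b : ℝ) :
    (a • A₀ + b • A₁) * S + S * (a • A₀ + b • A₁)ᵀ = -(a • D₀ + b • D₁) := by
  calc (a • A₀ + b • A₁) * S + S * (a • A₀ + b • A₁)ᵀ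
      = a • (A₀ * S + S * A₀ᵀ) + b • (A₁ * S + S * A₁ᵀ) := by
        simp only [transpose_add, transpose_smul, add_mul, mul_add, smul_mul_assoc,
          mul_smul_comm, smul_add]
        abel
    _ = -(a • D₀ + b • D₁) := by rw [h₀, h₁, smul_neg, smul_neg, neg_add]

/-- The line through a Lyapunov parametrization vanishing at `e` and one of full support contains a
parametrization of full support whose weight at `e` has the opposite sign. -/
lemma SignZero.exists_neg_mul {d : ℕ} {E : Set (Fin d × Fin d)} {e : Fin d × Fin d}
    {S A₁ D₁ : Matrix (Fin d) (Fin d) ℝ} (hZ : SignZero E e S) (hD₁ : IsDiagPos D₁)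
    (hA₁ : A₁ * S + S * A₁ᵀ = -D₁) (hE₁ : ∀ i j, A₁ i j ≠ 0 ↔ (i, j) ∈ E) :
    ∃ t < (0 : ℝ), ∃ A D : Matrix (Fin d) (Fin d) ℝ, IsDiagPos D ∧
      A * S + S * Aᵀ = -D ∧ (∀ i j, A i j ≠ 0 ↔ (i, j) ∈ E) ∧ A e.1 e.2 = t * A₁ e.1 e.2 := by
  obtain ⟨A₀, D₀, hD₀, hA₀, hE₀, he₀⟩ := hZ
  have tendsto_line (a b : ℝ) :
      Filter.Tendsto (fun t : ℝ => (1 - t) * a + t * b) (nhdsWithin 0 (Set.Iio 0)) (nhds a) := by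
    have h : Continuous fun t : ℝ => (1 - t) * a + t * b := by fun_prop
    simpa using (h.tendsto 0).mono_left nhdsWithin_le_nhds
  have hneg : ∀ᶠ t : ℝ in nhdsWithin 0 (Set.Iio 0), t < 0 := self_mem_nhdsWithin
  have hdiag : ∀ᶠ t : ℝ in nhdsWithin 0 (Set.Iio 0),
      ∀ i, 0 < (1 - t) * D₀ i i + t * D₁ i i :=
    Filter.eventually_all.2 fun i => (tendsto_line _ _).eventually_const_lt (hD₀.1 i)
  have hsupp : ∀ᶠ t : ℝ in nhdsWithin 0 (Set.Iio 0),
      ∀ i j, (i, j) ∈ E → (1 - t) * A₀ i j + t * A₁ i j ≠ 0 := by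
    refine Filter.eventually_all.2 fun i => Filter.eventually_all.2 fun j => ?_
    by_cases h : A₀ i j = 0
    · filter_upwards [hneg] with t ht hij
      simpa [h] using And.intro ht.ne ((hE₁ i j).2 hij)
    · filter_upwards [(tendsto_line (A₀ i j) (A₁ i j)).eventually_ne h] with t ht _ using ht
  obtain ⟨t, ht, htD, htE⟩ := (hneg.and (hdiag.and hsupp)).exists
  refine ⟨t, ht, (1 - t) • A₀ + t • A₁, (1 - t) • D₀ + t • D₁,
    ⟨fun i => by simpa using htD i, fun i j hij => by simp [hD₀.2 i j hij, hD₁.2 i j hij]⟩,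
    lyapunov_combination hA₀ hA₁ _ _, fun i j => ⟨fun h => ?_, fun h => by simpa using htE i j h⟩,
    by simp [he₀]⟩
  by_contra hij
  exact h (by simp [hE₀ i j hij, not_not.1 (mt (hE₁ i j).1 hij)])

theorem stmt_3 (d : ℕ) (hd : 1 ≤ d) (E : Set (Fin d × Fin d)) (e : Fin d × Fin d)
    (he : e ∈ E) (S : Matrix (Fin d) (Fin d) ℝ) (hS : S.PosDef)
    (hp : SignPos E e S ∨ SignNeg E e S) :
    SignZero E e S ↔ SignPos E e S ∧ SignNeg E e S := by
  constructor
  · intro hZ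
    rcases hp with hP | hN
    · refine ⟨hP, ?_⟩
      obtain ⟨A₁, D₁, hD₁, hA₁, hE₁, he₁⟩ := hP
      obtain ⟨t, ht, A, D, hD, hA, hE, hAe⟩ := hZ.exists_neg_mul hD₁ hA₁ hE₁
      exact ⟨A, D, hD, hA, hE, hAe ▸ mul_neg_of_neg_of_pos ht he₁⟩
    · refine ⟨?_, hN⟩
      obtain ⟨A₁, D₁, hD₁, hA₁, hE₁, he₁⟩ := hN
      obtain ⟨t, ht, A, D, hD, hA, hE, hAe⟩ := hZ.exists_neg_mul hD₁ hA₁ hE₁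
      exact ⟨A, D, hD, hA, hE, hAe ▸ mul_pos_of_neg_of_neg ht he₁⟩
  · rintro ⟨⟨A, D, hD, hA, hE, hAe⟩, ⟨B, F, hF, hB, hEB, hBe⟩⟩
    refine ⟨(-B e.1 e.2) • A + A e.1 e.2 • B, (-B e.1 e.2) • D + A e.1 e.2 • F,
      ⟨fun i => ?_, fun i j hij => by simp [hD.2 i j hij, hF.2 i j hij]⟩,
      lyapunov_combination hA hB _ _, fun i j hij => ?_, ?_⟩
    · exact add_pos (mul_pos (neg_pos.2 hBe) (hD.1 i)) (mul_pos hAe (hF.1 i))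
    · simp [not_not.1 (mt (hE i j).1 hij), not_not.1 (mt (hEB i j).1 hij)]
    · simp [mul_comm]
end

section
/- Let d ≥ 1, let E be a set of matrix positions (pairs (i,j) with 1 ≤ i,j ≤ d), let e ∈ E, and let Σ be a symmetric positive definite real d×d matrix. Define: P := 'there exist real d×d matrices A, D with D symmetric positive definite, AΣ + ΣAᵀ = −D, supp(A) = E, and the entry of A at position e strictly positive'; N := the same with the entry of A at position e strictly negative; Z := 'there exist real d×d matrices A, D with D symmetric positive definite, AΣ + ΣAᵀ = −D, supp(A) ⊆ E, and the entry of A at position e equal to 0'. If P or N holds, then Z holds if and only if both P and N hold. -/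
open Matrix

/-- There is a Lyapunov parametrization of `S` with positive definite diffusion,
support exactly `E` and positive weight at `e`. -/
def SignPosPD {d : ℕ} (E : Set (Fin d × Fin d)) (e : Fin d × Fin d)
    (S : Matrix (Fin d) (Fin d) ℝ) : Prop :=
  ∃ A D : Matrix (Fin d) (Fin d) ℝ, D.PosDef ∧
    A * S + S * Aᵀ = -D ∧ (∀ i j, A i j ≠ 0 ↔ (i, j) ∈ E) ∧ 0 < A e.1 e.2

/-- There is a Lyapunov parametrization of `S` with positive definite diffusion,
support exactly `E` and negative weight at `e`. -/
def SignNegPD {d : ℕ} (E : Set (Fin d × Fin d)) (e : Fin d × Fin d)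
    (S : Matrix (Fin d) (Fin d) ℝ) : Prop :=
  ∃ A D : Matrix (Fin d) (Fin d) ℝ, D.PosDef ∧
    A * S + S * Aᵀ = -D ∧ (∀ i j, A i j ≠ 0 ↔ (i, j) ∈ E) ∧ A e.1 e.2 < 0

/-- There is a Lyapunov parametrization of `S` with positive definite diffusion,
support contained in `E` and zero weight at `e`. -/
def SignZeroPD {d : ℕ} (E : Set (Fin d × Fin d)) (e : Fin d × Fin d)
    (S : Matrix (Fin d) (Fin d) ℝ) : Prop :=
  ∃ A D : Matrix (Fin d) (Fin d) ℝ, D.PosDef ∧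
    A * S + S * Aᵀ = -D ∧ (∀ i j, (i, j) ∉ E → A i j = 0) ∧ A e.1 e.2 = 0

open Filter Topology

/-- Positive definiteness is stable under small symmetric perturbations. -/
theorem Matrix.PosDef.eventually_add_smul {n : Type*} [Fintype n] {M H : Matrix n n ℝ}
    (hM : M.PosDef) (hH : H.IsHermitian) : ∀ᶠ t : ℝ in 𝓝 0, (M + t • H).PosDef := by
  have hsphere : ∀ᶠ t : ℝ in 𝓝 0, ∀ x ∈ Metric.sphere (0 : n → ℝ) 1,
      0 < x ⬝ᵥ ((M + t • H) *ᵥ x) := by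
    refine (isCompact_sphere (0 : n → ℝ) 1).eventually_forall_of_forall_eventually
      fun x hx => ?_
    have hcont : Continuous fun p : ℝ × (n → ℝ) => p.2 ⬝ᵥ ((M + p.1 • H) *ᵥ p.2) := by
      fun_prop
    refine hcont.continuousAt.eventually (lt_mem_nhds ?_)
    have hx0 : x ≠ 0 := ne_zero_of_mem_unit_sphere ⟨x, hx⟩
    simpa using hM.dotProduct_mulVec_pos hx0
  filter_upwards [hsphere] with t ht
  refine posDef_iff_dotProduct_mulVec.mpr
    ⟨hM.isHermitian.add (hH.smul (IsSelfAdjoint.all t)), fun x hx => ?_⟩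
  have hunit := ht (‖x‖⁻¹ • x) (by simp [norm_smul, hx])
  rw [mulVec_smul, smul_dotProduct, dotProduct_smul, smul_eq_mul, smul_eq_mul,
    ← mul_assoc] at hunit
  exact pos_of_mul_pos_right hunit (by positivity)

/-- Lyapunov equations are compatible with linear combinations. -/
theorem lyapunov_linear_combination {n : Type*} [Fintype n] {A B D F S : Matrix n n ℝ}
    (hA : A * S + S * Aᵀ = -D) (hB : B * S + S * Bᵀ = -F) (a b : ℝ) :
    (a • A + b • B) * S + S * (a • A + b • B)ᵀ = -(a • D + b • F) := by
  have hsum := congrArg₂ (fun X Y => a • X + b • Y) hA hB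
  simp only [smul_add, smul_neg] at hsum
  rw [transpose_add, transpose_smul, transpose_smul, add_mul, mul_add, smul_mul, smul_mul,
    Matrix.mul_smul, Matrix.mul_smul, neg_add, ← hsum]
  abel

/-- A linear perturbation with support `E` of a matrix supported in `E` has support exactly `E`
for all sufficiently small nonzero parameters. -/
theorem eventually_support_add_smul {m n : Type*} [Finite m] [Finite n] {E : Set (m × n)}
    {A B : Matrix m n ℝ} (hA : ∀ i j, (i, j) ∉ E → A i j = 0)
    (hB : ∀ i j, B i j ≠ 0 ↔ (i, j) ∈ E) :
    ∀ᶠ t : ℝ in 𝓝[≠] 0, ∀ i j, (A + t • B) i j ≠ 0 ↔ (i, j) ∈ E := by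
  simp only [eventually_all]
  intro i j
  by_cases hE : (i, j) ∈ E
  · have hBij := (hB i j).2 hE
    simp only [hE, iff_true, Matrix.add_apply, Matrix.smul_apply, smul_eq_mul]
    by_cases hAij : A i j = 0
    · filter_upwards [self_mem_nhdsWithin] with t ht
      simpa [hAij, hBij] using ht
    · have hcont : Continuous fun t : ℝ => A i j + t * B i j := by fun_prop
      exact nhdsWithin_le_nhds (hcont.continuousAt.eventually_ne (by simpa using hAij))
  · have hBij : B i j = 0 := not_not.1 (mt (hB i j).1 hE)
    simp [hE, hBij, hA i j hE]

/-- Perturbing a parametrization vanishing at `e` along one with full support `E` produces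
both signs at `e`. -/
theorem SignZeroPD.signPosPD_and_signNegPD {d : ℕ} {E : Set (Fin d × Fin d)}
    {e : Fin d × Fin d} {S B F : Matrix (Fin d) (Fin d) ℝ} (hZ : SignZeroPD E e S)
    (he : e ∈ E) (hF : F.PosDef) (hlyap : B * S + S * Bᵀ = -F)
    (hB : ∀ i j, B i j ≠ 0 ↔ (i, j) ∈ E) : SignPosPD E e S ∧ SignNegPD E e S := by
  obtain ⟨A, D, hD, hA, hsupp, hAe⟩ := hZ
  have hBe : B e.1 e.2 ≠ 0 := (hB _ _).2 he
  have hev := (hD.eventually_add_smul hF.isHermitian).filter_mono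
    (nhdsWithin_le_nhds (s := {0}ᶜ)) |>.and (eventually_support_add_smul hsupp hB)
  have heq (t : ℝ) : (A + t • B) * S + S * (A + t • B)ᵀ = -(D + t • F) := by
    simpa using lyapunov_linear_combination hA hlyap 1 t
  have hentry (t : ℝ) : (A + t • B) e.1 e.2 = t * B e.1 e.2 := by simp [hAe]
  obtain ⟨t, ⟨hDt, hEt⟩, ht⟩ :=
    ((hev.filter_mono (nhdsGT_le_nhdsNE (0 : ℝ))).and
      (self_mem_nhdsWithin (s := Set.Ioi (0 : ℝ)))).exists
  obtain ⟨s, ⟨hDs, hEs⟩, hs⟩ :=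
    ((hev.filter_mono (nhdsLT_le_nhdsNE (0 : ℝ))).and
      (self_mem_nhdsWithin (s := Set.Iio (0 : ℝ)))).exists
  rcases hBe.lt_or_gt with hneg | hpos
  · exact ⟨⟨_, _, hDs, heq s, hEs, hentry s ▸ mul_pos_of_neg_of_neg hs hneg⟩,
      ⟨_, _, hDt, heq t, hEt, hentry t ▸ mul_neg_of_pos_of_neg ht hneg⟩⟩
  · exact ⟨⟨_, _, hDt, heq t, hEt, hentry t ▸ mul_pos ht hpos⟩,
      ⟨_, _, hDs, heq s, hEs, hentry s ▸ mul_neg_of_neg_of_pos hs hpos⟩⟩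

/-- A suitable positive combination of parametrizations with opposite signs at `e`
vanishes at `e`. -/
theorem SignPosPD.signZeroPD {d : ℕ} {E : Set (Fin d × Fin d)} {e : Fin d × Fin d}
    {S : Matrix (Fin d) (Fin d) ℝ} (hP : SignPosPD E e S) (hN : SignNegPD E e S) :
    SignZeroPD E e S := by
  obtain ⟨A, D, hD, hA, hAE, hAe⟩ := hP
  obtain ⟨B, F, hF, hB, hBE, hBe⟩ := hN
  refine ⟨(-B e.1 e.2) • A + A e.1 e.2 • B, (-B e.1 e.2) • D + A e.1 e.2 • F,
    (hD.smul (neg_pos.2 hBe)).add (hF.smul hAe),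
    lyapunov_linear_combination hA hB _ _, fun i j hij => ?_, ?_⟩
  · have hAij : A i j = 0 := not_not.1 (mt (hAE i j).1 hij)
    have hBij : B i j = 0 := not_not.1 (mt (hBE i j).1 hij)
    simp [hAij, hBij]
  · simp only [Matrix.add_apply, Matrix.smul_apply, smul_eq_mul]
    ring

theorem stmt_6 (d : ℕ) (hd : 1 ≤ d) (E : Set (Fin d × Fin d)) (e : Fin d × Fin d)
    (he : e ∈ E) (S : Matrix (Fin d) (Fin d) ℝ) (hS : S.PosDef)
    (hp : SignPosPD E e S ∨ SignNegPD E e S) :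
    SignZeroPD E e S ↔ SignPosPD E e S ∧ SignNegPD E e S := by
  refine ⟨fun hZ => ?_, fun h => h.1.signZeroPD h.2⟩
  obtain ⟨B, F, hF, hB, hBE, -⟩ | ⟨B, F, hF, hB, hBE, -⟩ := hp <;>
    exact hZ.signPosPD_and_signNegPD he hF hB hBE
end

section
/- Let d ≥ 1, let E be a set of matrix positions (pairs (i,j) with 1 ≤ i,j ≤ d), and let e ∈ E. Let E' = E \ {e}. Suppose there exist indices i, j such that i and j have a common ancestor with respect to E but have no common ancestor with respect to E'. Then for every symmetric positive definite real d×d matrix Σ that is m-faithful to E, it is NOT the case that both of the following hold: (a) there exist A⁺, D⁺ with D⁺ diagonal with strictly positive diagonal entries, A⁺Σ + Σ(A⁺)ᵀ = −D⁺, supp(A⁺) = E, and the entry of A⁺ at position e strictly positive; and (b) there exist A⁻, D⁻ with D⁻ diagonal with strictly positive diagonal entries, A⁻Σ + Σ(A⁻)ᵀ = −D⁻, supp(A⁻) = E, and the entry of A⁻ at position e strictly negative. (Thus the sign of the edge e is identifiable whenever removing e changes the entailed marginal independences.) -/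
open Matrix

/-- `k` is an ancestor of `i` with respect to the edge set `E`, where the
position `(i, j)` encodes the directed edge `j → i`: there is a directed path
of length at least one from `k` to `i`. -/
def Anc {d : ℕ} (E : Set (Fin d × Fin d)) (k i : Fin d) : Prop :=
  Relation.TransGen (fun a b => (b, a) ∈ E) k i

/-- `S` is m-faithful to the edge set `E`: an entry of `S` vanishes exactly
when the corresponding pair of nodes has no common ancestor. -/
def MFaithful {d : ℕ} (E : Set (Fin d × Fin d)) (S : Matrix (Fin d) (Fin d) ℝ) : Prop :=
  ∀ i j, S i j = 0 ↔ ¬ ∃ k, Anc E k i ∧ Anc E k j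

namespace Matrix

variable {n : Type*} [Fintype n]

/-- A positive definite solution of the Lyapunov equation with positive definite right-hand side
forces the symmetric solutions of the homogeneous Lyapunov equation to vanish. -/
theorem PosDef.eq_zero_of_lyapunov [DecidableEq n] {A S D Y : Matrix n n ℝ} (hS : S.PosDef)
    (hD : D.PosDef) (hAS : A * S + S * Aᵀ = -D) (hY : Y.IsHermitian)
    (hAY : A * Y + Y * Aᵀ = 0) : Y = 0 := by
  obtain ⟨C, hC, rfl⟩ : ∃ C : Matrix n n ℝ, IsUnit C ∧ S = Cᵀ * C := by
    open scoped MatrixOrder Matrix.Norms.L2Operator in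
    simpa [star_eq_conjTranspose] using
      CStarAlgebra.isStrictlyPositive_iff_eq_star_mul_self.mp hS.isStrictlyPositive
  have hdet : IsUnit C.det := (isUnit_iff_isUnit_det C).mp hC
  have hdet' : IsUnit Cᵀ.det := by rwa [det_transpose]
  have hYt : Yᵀ = Y := by simpa using hY.eq
  have hZ : (C⁻¹ᵀ * Y * C⁻¹).IsHermitian := by
    simp [IsHermitian, hYt, Matrix.mul_assoc]
  have hYZ : Y = Cᵀ * (C⁻¹ᵀ * Y * C⁻¹) * C := by
    rw [transpose_nonsing_inv]
    simp only [← Matrix.mul_assoc, mul_nonsing_inv _ hdet', Matrix.one_mul]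
    rw [Matrix.mul_assoc, nonsing_inv_mul _ hdet, Matrix.mul_one]
  generalize C⁻¹ᵀ * Y * C⁻¹ = Z at hZ hYZ
  suffices hZ0 : Z = 0 by rw [hYZ, hZ0]; simp
  rw [← hZ.eigenvalues_eq_zero_iff]
  funext k
  let w : n → ℝ := (hZ.eigenvectorBasis k).ofLp
  have hw0 : w ≠ 0 := fun h =>
    hZ.eigenvectorBasis.orthonormal.ne_zero k (by ext i; exact congrFun h i)
  have hZw : Z *ᵥ w = hZ.eigenvalues k • w := hZ.mulVec_eigenvectorBasis k
  obtain ⟨v, hCv⟩ : ∃ v, C *ᵥ v = w :=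
    ⟨C⁻¹ *ᵥ w, by rw [mulVec_mulVec, mul_nonsing_inv _ hdet, one_mulVec]⟩
  have hv0 : v ≠ 0 := fun h => hw0 (by rw [← hCv, h, mulVec_zero])
  have hYv : Y *ᵥ v = hZ.eigenvalues k • ((Cᵀ * C) *ᵥ v) := by
    calc Y *ᵥ v = Cᵀ *ᵥ (Z *ᵥ (C *ᵥ v)) := by rw [mulVec_mulVec, mulVec_mulVec, ← hYZ]
      _ = hZ.eigenvalues k • ((Cᵀ * C) *ᵥ v) := by
        rw [← mulVec_mulVec, hCv, hZw, mulVec_smul]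
  have hquad : ∀ M : Matrix n n ℝ, Mᵀ = M →
      v ⬝ᵥ ((A * M + M * Aᵀ) *ᵥ v) = 2 * (v ⬝ᵥ (A *ᵥ (M *ᵥ v))) := by
    intro M hM
    have : v ⬝ᵥ (M *ᵥ (Aᵀ *ᵥ v)) = v ⬝ᵥ (A *ᵥ (M *ᵥ v)) := by
      rw [dotProduct_mulVec, ← mulVec_transpose, hM, mulVec_transpose, dotProduct_comm,
        ← dotProduct_mulVec]
    rw [add_mulVec, dotProduct_add, ← mulVec_mulVec, ← mulVec_mulVec, this, two_mul]
  have hvD : 0 < v ⬝ᵥ (D *ᵥ v) := by simpa using hD.dotProduct_mulVec_pos hv0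
  have hvS := hquad (Cᵀ * C) (by simp)
  have hvY := hquad Y hYt
  rw [hAS, neg_mulVec, dotProduct_neg] at hvS
  rw [hAY, zero_mulVec, dotProduct_zero, hYv, mulVec_smul, dotProduct_smul, smul_eq_mul] at hvY
  have hne : v ⬝ᵥ (A *ᵥ ((Cᵀ * C) *ᵥ v)) ≠ 0 := by
    intro h
    rw [h] at hvS
    linarith
  have : hZ.eigenvalues k * (v ⬝ᵥ (A *ᵥ ((Cᵀ * C) *ᵥ v))) = 0 := by linarith
  exact (mul_eq_zero.mp this).resolve_right hne

/-- If the drift and the diffusion are block diagonal for the partition of the indices given by `p`,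
then so is the positive definite solution of the Lyapunov equation. -/
theorem PosDef.apply_eq_zero_of_lyapunov_block {A S D : Matrix n n ℝ} (hS : S.PosDef)
    (hD : D.PosDef) (hAS : A * S + S * Aᵀ = -D) (p : n → Prop)
    (hA : ∀ a b, A a b ≠ 0 → (p a ↔ p b)) (hDp : ∀ a b, ¬(p a ↔ p b) → D a b = 0)
    {a b : n} (hab : ¬(p a ↔ p b)) : S a b = 0 := by
  classical
  have hSt : ∀ a b, S a b = S b a := fun a b => by simpa using hS.isHermitian.apply b a
  let Y : Matrix n n ℝ := fun a b => if p a ↔ p b then 0 else S a b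
  have hY : Y.IsHermitian := by
    refine IsHermitian.ext fun a b => ?_
    simp only [star_trivial, Y, hSt b a, iff_comm (a := p b)]
  have hAY : A * Y + Y * Aᵀ = 0 := by
    ext a b
    have hl : (A * Y) a b = if p a ↔ p b then 0 else (A * S) a b := by
      rw [mul_apply, mul_apply, ← Finset.sum_const_zero (s := (Finset.univ : Finset n)),
        ← Finset.sum_ite_irrel]
      refine Finset.sum_congr rfl fun k _ => ?_
      by_cases hk : A a k = 0
      · simp [hk]
      · simp [Y, hA a k hk]
    have hr : (Y * Aᵀ) a b = if p a ↔ p b then 0 else (S * Aᵀ) a b := by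
      rw [mul_apply, mul_apply, ← Finset.sum_const_zero (s := (Finset.univ : Finset n)),
        ← Finset.sum_ite_irrel]
      refine Finset.sum_congr rfl fun k _ => ?_
      by_cases hk : A b k = 0
      · simp [hk]
      · simp [Y, hA b k hk]
    rw [add_apply, hl, hr]
    split_ifs with h
    · simp
    · rw [← add_apply, hAS, neg_apply, hDp a b h, neg_zero, zero_apply]
  have := congrFun (congrFun (hS.eq_zero_of_lyapunov hD hAS hY hAY) a) b
  simpa [Y, hab] using this

end Matrix

theorem IsDiagPos.posDef {d : ℕ} {D : Matrix (Fin d) (Fin d) ℝ} (hD : IsDiagPos D) :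
    D.PosDef := by
  have : D = Matrix.diagonal fun i => D i i := by
    ext i j
    by_cases h : i = j
    · simp [h]
    · simp [h, hD.2 i j h]
  rw [this]
  exact Matrix.PosDef.diagonal hD.1

/-- If the Lyapunov equation holds for a drift matrix supported in `F` and a diagonal diffusion
matrix with positive diagonal entries, then every node has an incoming edge in `F`. -/
theorem exists_parent_of_lyapunov {d : ℕ} {F : Set (Fin d × Fin d)}
    {A S D : Matrix (Fin d) (Fin d) ℝ} (hD : IsDiagPos D) (hAS : A * S + S * Aᵀ = -D)
    (hA : ∀ i j, A i j ≠ 0 → (i, j) ∈ F) (i : Fin d) : ∃ k, (i, k) ∈ F := by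
  by_contra! h
  have h0 : ∀ k, A i k = 0 := fun k => by_contra fun hk => h k (hA i k hk)
  have := congrFun (congrFun hAS i) i
  simp only [Matrix.add_apply, mul_apply, transpose_apply, h0, Matrix.neg_apply] at this
  have hpos := hD.1 i
  simp at this
  linarith

/-- A positive definite solution of the Lyapunov equation has a vanishing entry wherever the two
nodes have no common ancestor in a graph supporting the drift matrix. -/
theorem apply_eq_zero_of_lyapunov_of_no_common_anc {d : ℕ} {F : Set (Fin d × Fin d)}
    {A S D : Matrix (Fin d) (Fin d) ℝ} (hS : S.PosDef) (hD : IsDiagPos D)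
    (hAS : A * S + S * Aᵀ = -D) (hA : ∀ i j, A i j ≠ 0 → (i, j) ∈ F) {i j : Fin d}
    (hij : ¬ ∃ k, Anc F k i ∧ Anc F k j) : S i j = 0 := by
  classical
  let P : Fin d → Fin d → Prop := Relation.ReflTransGen fun a b => (b, a) ∈ F
  have hdisj : ∀ k, P k i → ¬ P k j := fun k hi hj => by
    obtain ⟨m, hm⟩ := exists_parent_of_lyapunov hD hAS hA k
    exact hij ⟨m, Relation.TransGen.head' hm hi, Relation.TransGen.head' hm hj⟩
  have hstep : ∀ a b l, A a b ≠ 0 → P a l → P b l := fun a b l hab h =>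
    Relation.ReflTransGen.head (hA a b hab) h
  let T := {k : Fin d // P k i ∨ P k j}
  let f : T → Fin d := Subtype.val
  have hf : Function.Injective f := Subtype.val_injective
  have hsum : ∀ (a : T) (g : Fin d → ℝ), ∑ k : T, A a k * g k = ∑ k, A a k * g k := by
    intro a g
    refine Fintype.sum_of_injective f hf _ _ (fun k hk => ?_) fun k => rfl
    by_contra hne
    have hak : A a k ≠ 0 := left_ne_zero_of_mul hne
    exact hk ⟨⟨k, a.2.imp (hstep _ _ _ hak) (hstep _ _ _ hak)⟩, rfl⟩
  have hAT : A.submatrix f f * S.submatrix f f + S.submatrix f f * (A.submatrix f f)ᵀ =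
      -D.submatrix f f := by
    ext a b
    have hab := congrFun (congrFun hAS (f a)) (f b)
    have hl := hsum a fun k => S k (f b)
    have hr := hsum b fun k => S (f a) k
    simp only [Matrix.add_apply, mul_apply, transpose_apply, Matrix.neg_apply,
      submatrix_apply] at hab ⊢
    simp only [mul_comm (S _ _)] at hab ⊢
    rw [← hab]
    exact congrArg₂ (· + ·) hl hr
  refine (hS.submatrix hf).apply_eq_zero_of_lyapunov_block (hD.posDef.submatrix hf) hAT
    (fun k => P k i) (fun a b hab => ?_) (fun a b hab => ?_)
    (a := ⟨i, Or.inl .refl⟩) (b := ⟨j, Or.inr .refl⟩) ?_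
  · refine ⟨hstep _ _ _ hab, fun hb => a.2.resolve_right fun ha => ?_⟩
    exact hdisj b hb (hstep _ _ _ hab ha)
  · exact hD.2 _ _ fun h => hab (by rw [hf h])
  · exact fun h => hdisj j (h.mp .refl) .refl

theorem stmt_7 (d : ℕ) (hd : 1 ≤ d) (E : Set (Fin d × Fin d)) (e : Fin d × Fin d)
    (he : e ∈ E)
    (hsep : ∃ i j : Fin d, (∃ k, Anc E k i ∧ Anc E k j) ∧
      ¬ ∃ k, Anc (E \ {e}) k i ∧ Anc (E \ {e}) k j) :
    ∀ S : Matrix (Fin d) (Fin d) ℝ, S.PosDef → MFaithful E S →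
      ¬ ((∃ A D : Matrix (Fin d) (Fin d) ℝ, IsDiagPos D ∧
            A * S + S * Aᵀ = -D ∧ (∀ i j, A i j ≠ 0 ↔ (i, j) ∈ E) ∧ 0 < A e.1 e.2) ∧
         (∃ A D : Matrix (Fin d) (Fin d) ℝ, IsDiagPos D ∧
            A * S + S * Aᵀ = -D ∧ (∀ i j, A i j ≠ 0 ↔ (i, j) ∈ E) ∧ A e.1 e.2 < 0)) := by
  rintro S hS hfaith ⟨⟨A₁, D₁, hD₁, h₁, hs₁, he₁⟩, A₂, D₂, hD₂, h₂, hs₂, he₂⟩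
  obtain ⟨i, j, hE, hE'⟩ := hsep
  set s := -A₂ e.1 e.2 with hs
  set t := A₁ e.1 e.2 with ht
  have hs0 : 0 < s := by linarith
  refine (hfaith i j).not.mpr (not_not.mpr hE)
    (apply_eq_zero_of_lyapunov_of_no_common_anc (F := E \ {e}) (A := s • A₁ + t • A₂)
      (D := s • D₁ + t • D₂) hS ⟨fun k => ?_, fun k l hkl => ?_⟩ ?_ (fun k l hkl => ⟨?_, ?_⟩) hE')
  · have := mul_pos hs0 (hD₁.1 k)
    have := mul_pos he₁ (hD₂.1 k)
    simp only [Matrix.add_apply, Matrix.smul_apply, smul_eq_mul]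
    positivity
  · simp [hD₁.2 k l hkl, hD₂.2 k l hkl]
  · calc (s • A₁ + t • A₂) * S + S * (s • A₁ + t • A₂)ᵀ
        = s • (A₁ * S + S * A₁ᵀ) + t • (A₂ * S + S * A₂ᵀ) := by
          simp only [transpose_add, transpose_smul, Matrix.add_mul, Matrix.mul_add, smul_mul,
            Matrix.mul_smul, smul_add]
          abel
      _ = -(s • D₁ + t • D₂) := by rw [h₁, h₂, smul_neg, smul_neg, neg_add]
  · by_contra hkE
    have hz₁ : A₁ k l = 0 := by_contra fun h => hkE ((hs₁ k l).mp h)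
    have hz₂ : A₂ k l = 0 := by_contra fun h => hkE ((hs₂ k l).mp h)
    exact hkl (by simp [hz₁, hz₂])
  · rintro rfl
    exact hkl (by simp only [Matrix.add_apply, Matrix.smul_apply, smul_eq_mul, hs, ht]; ring)
end

section
/- Let s_h, s_y, α, σ_hh, σ_hy, σ_yy, d_h, d_y be real numbers with s_h < 0, s_y < 0, d_h > 0, d_y > 0. Let A be the 2×2 matrix with rows (s_h, 0) and (α, s_y), let Σ be the symmetric 2×2 matrix with rows (σ_hh, σ_hy) and (σ_hy, σ_yy), and let D be the diagonal matrix diag(d_h, d_y). Assume Σ is positive definite and AΣ + ΣAᵀ = −D. If σ_hy ≠ 0, then α·σ_hy > 0; in particular α ≠ 0 and sign(α) = sign(σ_hy). -/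
open Matrix

theorem stmt_8 (s_h s_y α σhh σhy σyy d_h d_y : ℝ)
    (hsh : s_h < 0) (hsy : s_y < 0) (hdh : 0 < d_h) (hdy : 0 < d_y)
    (A S D : Matrix (Fin 2) (Fin 2) ℝ)
    (hA : A = !![s_h, 0; α, s_y])
    (hS : S = !![σhh, σhy; σhy, σyy])
    (hD : D = Matrix.diagonal ![d_h, d_y])
    (hpd : S.PosDef)
    (hlyap : A * S + S * Aᵀ = -D)
    (hσ : σhy ≠ 0) :
    0 < α * σhy := by
  have hσhh : 0 < σhh := by simpa [hS] using hpd.diag_pos (i := 0)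
  have hoff : α * σhh + s_y * σhy + σhy * s_h = 0 := by
    simpa [hA, hS, hD, Matrix.vecMul, dotProduct, Fin.sum_univ_two] using congrFun (congrFun hlyap 1) 0
  have hprod : α * σhy * σhh = -(s_h + s_y) * σhy ^ 2 := by
    linear_combination σhy * hoff
  refine pos_of_mul_pos_left ?_ hσhh.le
  rw [hprod]
  exact mul_pos (by linarith) (by positivity)
end

section
/- Let s_h, s_x, s_y, β, α and the entries of a symmetric 3×3 matrix Σ = (σ_hh, σ_hx, σ_hy; σ_hx, σ_xx, σ_xy; σ_hy, σ_xy, σ_yy) and d_h, d_x, d_y be real numbers with s_h < 0, s_x < 0, s_y < 0 and d_h, d_x, d_y > 0. Let A be the 3×3 matrix with rows (s_h, 0, 0), (β, s_x, 0), (0, α, s_y), and let D = diag(d_h, d_x, d_y). Assume Σ is positive definite and AΣ + ΣAᵀ = −D. If σ_hx ≠ 0 and σ_hy ≠ 0, then α·σ_hx·σ_hy > 0; in particular α ≠ 0 and sign(α) = sign(σ_hy)/sign(σ_hx). -/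
open Matrix

theorem stmt_9 (s_h s_x s_y β α σhh σhx σhy σxx σxy σyy d_h d_x d_y : ℝ)
    (hsh : s_h < 0) (hsx : s_x < 0) (hsy : s_y < 0)
    (hdh : 0 < d_h) (hdx : 0 < d_x) (hdy : 0 < d_y)
    (A S D : Matrix (Fin 3) (Fin 3) ℝ)
    (hA : A = !![s_h, 0, 0; β, s_x, 0; 0, α, s_y])
    (hS : S = !![σhh, σhx, σhy; σhx, σxx, σxy; σhy, σxy, σyy])
    (hD : D = Matrix.diagonal ![d_h, d_x, d_y])
    (hpd : S.PosDef)
    (hlyap : A * S + S * Aᵀ = -D)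
    (hhx : σhx ≠ 0) (hhy : σhy ≠ 0) :
    0 < α * σhx * σhy := by
  have hentry : s_h * σhy + (σhx * α + σhy * s_y) = 0 := by
    simpa [hA, hS, hD, Matrix.vecMul, dotProduct, Fin.sum_univ_three] using congr_fun₂ hlyap 0 2
  calc 0 < -(s_h + s_y) * σhy ^ 2 := mul_pos (by linarith) (by positivity)
    _ = α * σhx * σhy := by linear_combination -σhy * hentry
end

section
/- Let s_z, s_h, s_x, s_y, β, γ, δ, α and the entries of a symmetric 4×4 matrix Σ (indexed by the variable order (Z, H, X, Y), with entries σ_zz, σ_zh, σ_zx, σ_zy, σ_hh, σ_hx, σ_hy, σ_xx, σ_xy, σ_yy) and d_z, d_h, d_x, d_y be real numbers with s_z < 0, s_h < 0, s_x < 0, s_y < 0 and d_z, d_h, d_x, d_y > 0. Let A be the 4×4 matrix with rows (s_z, 0, 0, 0), (0, s_h, 0, 0), (β, γ, s_x, 0), (0, δ, α, s_y), and let D = diag(d_z, d_h, d_x, d_y). Assume Σ is positive definite, σ_zh = 0, and AΣ + ΣAᵀ = −D. If σ_zx ≠ 0 and σ_zy ≠ 0, then α·σ_zx·σ_zy > 0;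 in particular α ≠ 0 and sign(α) = sign(σ_zy)/sign(σ_zx). -/
open Matrix

theorem stmt_10 (s_z s_h s_x s_y β γ δ α σzz σzh σzx σzy σhh σhx σhy σxx σxy σyy
    d_z d_h d_x d_y : ℝ)
    (hsz : s_z < 0) (hsh : s_h < 0) (hsx : s_x < 0) (hsy : s_y < 0)
    (hdz : 0 < d_z) (hdh : 0 < d_h) (hdx : 0 < d_x) (hdy : 0 < d_y)
    (A S D : Matrix (Fin 4) (Fin 4) ℝ)
    (hA : A = !![s_z, 0, 0, 0; 0, s_h, 0, 0; β, γ, s_x, 0; 0, δ, α, s_y])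
    (hS : S = !![σzz, σzh, σzx, σzy; σzh, σhh, σhx, σhy;
                 σzx, σhx, σxx, σxy; σzy, σhy, σxy, σyy])
    (hD : D = Matrix.diagonal ![d_z, d_h, d_x, d_y])
    (hpd : S.PosDef)
    (hzh : σzh = 0)
    (hlyap : A * S + S * Aᵀ = -D)
    (hzx : σzx ≠ 0) (hzy : σzy ≠ 0) :
    0 < α * σzx * σzy := by
  have zy_entry : s_z * σzy + (σzx * α + σzy * s_y) = 0 := by
    have h := congrFun (congrFun hlyap 0) 3
    subst hA hS hD hzh
    rw [Matrix.add_apply, Matrix.mul_apply, Matrix.mul_apply] at h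
    simpa [Fin.sum_univ_four] using h
  have key : α * σzx * σzy = -(s_z + s_y) * σzy ^ 2 := by
    linear_combination σzy * zy_entry
  rw [key]
  exact mul_pos (by linarith) (by positivity)
end

section
/- Let s_z, s_h, s_x, s_y, β, γ, δ, α and the entries of a symmetric 4×4 matrix Σ (indexed by the variable order (Z, H, X, Y), with entries σ_zz, σ_zh, σ_zx, σ_zy, σ_hh, σ_hx, σ_hy, σ_xx, σ_xy, σ_yy) and d_z, d_h, d_x, d_y > 0 be real numbers. Let A be the 4×4 matrix with rows (s_z, 0, 0, 0), (0, s_h, 0, δ), (β, γ, s_x, 0), (0, 0, α, s_y), and let D = diag(d_z, d_h, d_x, d_y). Assume Σ is positive definite and AΣ + ΣAᵀ = −D, and assume σ_zx ≠ 0 and σ_zy ≠ 0. Then: if σ_zy·σ_xy/(σ_zx·σ_yy) < 1 then α·σ_zx·σ_zy > 0 (so sign(α) = sign(σ_zy/σ_zx)), and if σ_zy·σ_xy/(σ_zx·σ_yy) > 1 then α·σ_zx·σ_zy < 0 (so sign(α) = −sign(σ_zy/σ_zx)). -/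
open Matrix

theorem stmt_11 (s_z s_h s_x s_y β γ δ α σzz σzh σzx σzy σhh σhx σhy σxx σxy σyy
    d_z d_h d_x d_y : ℝ)
    (hdz : 0 < d_z) (hdh : 0 < d_h) (hdx : 0 < d_x) (hdy : 0 < d_y)
    (A S D : Matrix (Fin 4) (Fin 4) ℝ)
    (hA : A = !![s_z, 0, 0, 0; 0, s_h, 0, δ; β, γ, s_x, 0; 0, 0, α, s_y])
    (hS : S = !![σzz, σzh, σzx, σzy; σzh, σhh, σhx, σhy;
                 σzx, σhx, σxx, σxy; σzy, σhy, σxy, σyy])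
    (hD : D = Matrix.diagonal ![d_z, d_h, d_x, d_y])
    (hpd : S.PosDef)
    (hlyap : A * S + S * Aᵀ = -D)
    (hzx : σzx ≠ 0) (hzy : σzy ≠ 0) :
    (σzy * σxy / (σzx * σyy) < 1 → 0 < α * σzx * σzy) ∧
    (σzy * σxy / (σzx * σyy) > 1 → α * σzx * σzy < 0) := by
  have hzz : 0 < σzz := by simpa [hS] using hpd.diag_pos (i := 0)
  have hyy : 0 < σyy := by simpa [hS] using hpd.diag_pos (i := 3)
  have eq_zz := congrFun (congrFun hlyap 0) 0
  have eq_zy := congrFun (congrFun hlyap 0) 3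
  have eq_yy := congrFun (congrFun hlyap 3) 3
  simp [hA, hS, hD, Matrix.vecMul, dotProduct, Fin.sum_univ_four] at eq_zz eq_zy eq_yy
  have hsz : s_z < 0 := by
    by_contra! h
    nlinarith [mul_nonneg h hzz.le]
  have key : α * σzx * σzy * (1 - σzy * σxy / (σzx * σyy))
      = σzy ^ 2 * (-s_z + d_y / (2 * σyy)) := by
    field_simp
    linear_combination 2 * σyy * eq_zy - σzy * eq_yy
  have hpos : 0 < α * σzx * σzy * (1 - σzy * σxy / (σzx * σyy)) := by
    rw [key]
    have : 0 < d_y / (2 * σyy) := by positivity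
    exact mul_pos (by positivity) (by linarith)
  exact ⟨fun h => pos_of_mul_pos_left hpos (sub_pos.2 h).le,
    fun h => neg_of_mul_pos_left hpos (sub_neg.2 h).le⟩
end

section
/- Let s_z, s_h, s_x, s_y, β, γ, δ, α and the entries of a symmetric 4×4 matrix Σ (indexed by the variable order (Z, H, X, Y), with entries σ_zz, σ_zh, σ_zx, σ_zy, σ_hh, σ_hx, σ_hy, σ_xx, σ_xy, σ_yy) and d_z, d_h, d_x, d_y > 0 be real numbers. Let A be the 4×4 matrix with rows (s_z, 0, 0, 0), (0, s_h, 0, δ), (β, γ, s_x, 0), (0, 0, α, s_y), and let D = diag(d_z, d_h, d_x, d_y). Assume Σ is positive definite, AΣ + ΣAᵀ = −D, and σ_zx ≠ 0. Then σ_zy·σ_xy ≠ σ_zx·σ_yy. -/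
open Matrix

theorem stmt_12 (s_z s_h s_x s_y β γ δ α σzz σzh σzx σzy σhh σhx σhy σxx σxy σyy
    d_z d_h d_x d_y : ℝ)
    (hdz : 0 < d_z) (hdh : 0 < d_h) (hdx : 0 < d_x) (hdy : 0 < d_y)
    (A S D : Matrix (Fin 4) (Fin 4) ℝ)
    (hA : A = !![s_z, 0, 0, 0; 0, s_h, 0, δ; β, γ, s_x, 0; 0, 0, α, s_y])
    (hS : S = !![σzz, σzh, σzx, σzy; σzh, σhh, σhx, σhy;
                 σzx, σhx, σxx, σxy; σzy, σhy, σxy, σyy])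
    (hD : D = Matrix.diagonal ![d_z, d_h, d_x, d_y])
    (hpd : S.PosDef)
    (hlyap : A * S + S * Aᵀ = -D)
    (hzx : σzx ≠ 0) :
    σzy * σxy ≠ σzx * σyy := by
  intro h
  have hσzz : 0 < σzz := by simpa [hS] using hpd.diag_pos (i := 0)
  have hσyy : 0 < σyy := by simpa [hS] using hpd.diag_pos (i := 3)
  have hzz := congrFun₂ hlyap 0 0
  have hzy := congrFun₂ hlyap 0 3
  have hyy := congrFun₂ hlyap 3 3
  simp [hA, hS, hD, vecMul, dotProduct, Fin.sum_univ_four] at hzz hzy hyy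
  have hsz : s_z < 0 := by
    by_contra! hs
    nlinarith [mul_nonneg hs hσzz.le]
  have hα : α * σxy = -(s_z + s_y) * σyy :=
    mul_left_cancel₀ hzx (by linear_combination σxy * hzy - (s_z + s_y) * h)
  nlinarith [mul_pos (neg_pos.mpr hsz) hσyy]
end

section
/- Let s_h, s_x, s_y, γ, δ and the entries of a symmetric 3×3 matrix Σ = (σ_hh, σ_hx, σ_hy; σ_hx, σ_xx, σ_xy; σ_hy, σ_xy, σ_yy) and d_h, d_x, d_y > 0 be real numbers. Let A be the 3×3 matrix with rows (s_h, 0, 0), (γ, s_x, 0), (δ, 0, s_y) (note the (3,2) entry, the edge X → Y, is zero) and let D = diag(d_h, d_x, d_y). Assume Σ is positive definite, AΣ + ΣAᵀ = −D, and σ_hx ≠ 0, σ_hy ≠ 0, σ_xy ≠ 0. Then σ_hx·σ_hy·σ_xy > 0, i.e., sign(σ_hx·σ_hy) = sign(σ_xy). -/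
open Matrix

/-- The `2 × 2` principal minors of a real positive definite matrix are positive. -/
lemma Matrix.PosDef.minor_two_pos {n : Type*} {S : Matrix n n ℝ} (hS : S.PosDef)
    {i j : n} (hij : i ≠ j) : 0 < S i i * S j j - S i j * S j i := by
  have hinj : Function.Injective ![i, j] := by
    intro a b
    fin_cases a <;> fin_cases b <;> simp [hij, hij.symm]
  have hdet := (hS.submatrix hinj).det_pos
  rwa [Matrix.det_fin_two] at hdet

/-- In the two-dimensional Lyapunov equation of an edge `h → x`, the self-loop weight of the
child is negative as soon as that of the parent is. -/
lemma child_selfLoop_neg {s_h s_x γ a b c d : ℝ} (hs : s_h < 0) (ha : 0 < a) (hd : 0 < d)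
    (hdet : 0 < a * c - b * b) (hhx : s_h * b + γ * a + s_x * b = 0)
    (hxx : 2 * (γ * b + s_x * c) = -d) : s_x < 0 := by
  have key : s_x * (a * c - b * b) = s_h * b ^ 2 - d * a / 2 := by
    linear_combination a / 2 * hxx - b * hhx
  have hneg : s_x * (a * c - b * b) < 0 := by
    nlinarith [mul_pos hd ha, mul_nonneg (neg_nonneg.2 hs.le) (sq_nonneg b)]
  exact neg_of_mul_neg_left hneg hdet.le

theorem stmt_13 (s_h s_x s_y γ δ σhh σhx σhy σxx σxy σyy d_h d_x d_y : ℝ)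
    (hdh : 0 < d_h) (hdx : 0 < d_x) (hdy : 0 < d_y)
    (A S D : Matrix (Fin 3) (Fin 3) ℝ)
    (hA : A = !![s_h, 0, 0; γ, s_x, 0; δ, 0, s_y])
    (hS : S = !![σhh, σhx, σhy; σhx, σxx, σxy; σhy, σxy, σyy])
    (hD : D = Matrix.diagonal ![d_h, d_x, d_y])
    (hpd : S.PosDef)
    (hlyap : A * S + S * Aᵀ = -D)
    (hhx : σhx ≠ 0) (hhy : σhy ≠ 0) (hxy : σxy ≠ 0) :
    0 < σhx * σhy * σxy := by
  subst hA hS hD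
  have hhh : 0 < σhh := by simpa using hpd.diag_pos (i := 0)
  have hdetx : 0 < σhh * σxx - σhx * σhx := by
    simpa using hpd.minor_two_pos (i := 0) (j := 1) (by decide)
  have hdety : 0 < σhh * σyy - σhy * σhy := by
    simpa using hpd.minor_two_pos (i := 0) (j := 2) (by decide)
  have entry (i j : Fin 3) := congrFun (congrFun hlyap i) j
  have e00 := entry 0 0
  have e10 := entry 1 0
  have e20 := entry 2 0
  have e11 := entry 1 1
  have e22 := entry 2 2
  have e21 := entry 2 1
  simp [Matrix.vecMul, dotProduct, Fin.sum_univ_three] at e00 e10 e20 e11 e22 e21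
  have hsh : s_h < 0 := by
    by_contra! h
    nlinarith [mul_nonneg h hhh.le]
  have hsx : s_x < 0 := child_selfLoop_neg (γ := γ) hsh hhh hdx hdetx (by linarith) (by linarith)
  have hsy : s_y < 0 := child_selfLoop_neg (γ := δ) hsh hhh hdy hdety (by linarith) (by linarith)
  have key : (-(s_x + s_y) * σhh) * (σhx * σhy * σxy) =
      -(2 * s_h + s_x + s_y) * (σhx * σhy) ^ 2 := by
    linear_combination σhx * σhy * (σhy * e10 + σhx * e20 - σhh * e21)
  have hcoef : 0 < -(s_x + s_y) * σhh := mul_pos (by linarith) hhh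
  have hsq : 0 < (σhx * σhy) ^ 2 := by positivity
  refine pos_of_mul_pos_right ?_ hcoef.le
  rw [key]
  exact mul_pos (by linarith) hsq
end

section
/- Let s_h, s_x, s_y, γ, δ and the entries of a symmetric 3×3 matrix Σ = (σ_hh, σ_hx, σ_hy; σ_hx, σ_xx, σ_xy; σ_hy, σ_xy, σ_yy) and d_h, d_x, d_y > 0 be real numbers. Let A be the 3×3 matrix with rows (s_h, 0, 0), (γ, s_x, 0), (δ, 0, s_y) and let D = diag(d_h, d_x, d_y). Assume Σ is positive definite, AΣ + ΣAᵀ = −D, and σ_hx ≠ 0, σ_hy ≠ 0, σ_xy ≠ 0. Define the correlations ρ_hx = σ_hx/√(σ_hh·σ_xx), ρ_hy = σ_hy/√(σ_hh·σ_yy), ρ_xy = σ_xy/√(σ_xx·σ_yy). Then ρ_xy ≠ ρ_hx·ρ_hy and 2·ρ_hx·ρ_hy/(ρ_xy − ρ_hx·ρ_hy) > ρ_hx²/(1 − ρ_hx²) + ρ_hy²/(1 − ρ_hy²). -/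
open Matrix

/-- The principal `2 × 2` minors of a real positive definite matrix are positive. -/
lemma Matrix.PosDef.sq_apply_lt_mul_diag {n : Type*} [Fintype n] [DecidableEq n]
    {S : Matrix n n ℝ} (hS : S.PosDef) {i j : n} (hij : i ≠ j) :
    S i j ^ 2 < S i i * S j j := by
  have hi : 0 < S i i := hS.diag_pos
  have hsymm : S j i = S i j := by simpa using hS.isHermitian.apply i j
  have hv : Pi.single i (S i j) - Pi.single j (S i i) ≠ (0 : n → ℝ) := fun h => by
    have := congrFun h j
    simp [hij.symm, hi.ne'] at this
  have hq := hS.dotProduct_mulVec_pos hv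
  simp [Matrix.mulVec_sub, sub_dotProduct, hsymm] at hq
  have : 0 < S i i * (S i i * S j j - S i j ^ 2) := by linarith
  linarith [pos_of_mul_pos_right this hi.le]

/-- The Lyapunov equation bounds the ratio of the self-loop weight `s` of a child to that of its
single parent in terms of their correlation `a`; `p`, `q` are the standard deviations. -/
lemma correlation_odds_lt_of_lyapunov {t s γ a p q d : ℝ} (ht : t < 0) (hq : 0 < q)
    (ha : a ^ 2 < 1) (hd : 0 < d) (hcov : γ * p = -((s + t) * a * q))
    (hvar : 2 * (γ * (a * (p * q)) + s * q ^ 2) = -d) :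
    a ^ 2 / (1 - a ^ 2) < s / t := by
  have h : 2 * q ^ 2 * (s * (1 - a ^ 2) - t * a ^ 2) = -d := by
    linear_combination hvar - 2 * a * q * hcov
  have hneg : s * (1 - a ^ 2) - t * a ^ 2 < 0 := by
    by_contra! hn
    have : 0 ≤ 2 * q ^ 2 * (s * (1 - a ^ 2) - t * a ^ 2) := by positivity
    linarith
  have h1 : 0 < 1 - a ^ 2 := by linarith
  rw [lt_div_iff_of_neg ht, div_mul_eq_mul_div, lt_div_iff₀ h1]
  linarith

theorem stmt_14 (s_h s_x s_y γ δ σhh σhx σhy σxx σxy σyy d_h d_x d_y : ℝ)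
    (hdh : 0 < d_h) (hdx : 0 < d_x) (hdy : 0 < d_y)
    (A S D : Matrix (Fin 3) (Fin 3) ℝ)
    (hA : A = !![s_h, 0, 0; γ, s_x, 0; δ, 0, s_y])
    (hS : S = !![σhh, σhx, σhy; σhx, σxx, σxy; σhy, σxy, σyy])
    (hD : D = Matrix.diagonal ![d_h, d_x, d_y])
    (hpd : S.PosDef)
    (hlyap : A * S + S * Aᵀ = -D)
    (hhx : σhx ≠ 0) (hhy : σhy ≠ 0) (hxy : σxy ≠ 0)
    (ρhx ρhy ρxy : ℝ)
    (hρhx : ρhx = σhx / Real.sqrt (σhh * σxx))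
    (hρhy : ρhy = σhy / Real.sqrt (σhh * σyy))
    (hρxy : ρxy = σxy / Real.sqrt (σxx * σyy)) :
    ρxy ≠ ρhx * ρhy ∧
      ρhx ^ 2 / (1 - ρhx ^ 2) + ρhy ^ 2 / (1 - ρhy ^ 2) <
        2 * ρhx * ρhy / (ρxy - ρhx * ρhy) := by
  have hσhh : 0 < σhh := by simpa [hS] using hpd.diag_pos (i := 0)
  have hσxx : 0 < σxx := by simpa [hS] using hpd.diag_pos (i := 1)
  have hσyy : 0 < σyy := by simpa [hS] using hpd.diag_pos (i := 2)
  have hminx : σhx ^ 2 < σhh * σxx := by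
    simpa [hS] using hpd.sq_apply_lt_mul_diag (i := 0) (j := 1) (by decide)
  have hminy : σhy ^ 2 < σhh * σyy := by
    simpa [hS] using hpd.sq_apply_lt_mul_diag (i := 0) (j := 2) (by decide)
  have entry (i j : Fin 3) : (A * S + S * Aᵀ) i j = (-D) i j := by rw [hlyap]
  simp only [Matrix.add_apply, Matrix.mul_apply, Fin.sum_univ_three] at entry
  have ehh := entry 0 0
  have ehx := entry 0 1
  have ehy := entry 0 2
  have exx := entry 1 1
  have exy := entry 1 2
  have eyy := entry 2 2
  simp [hA, hS, hD] at ehh ehx ehy exx exy eyy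
  have hsh : s_h < 0 := by
    by_contra! hn
    have : 0 ≤ s_h * σhh := by positivity
    linarith
  have hρhx_lt : ρhx ^ 2 < 1 := by
    rw [hρhx, div_pow, Real.sq_sqrt (by positivity), div_lt_one (by positivity)]
    exact hminx
  have hρhy_lt : ρhy ^ 2 < 1 := by
    rw [hρhy, div_pow, Real.sq_sqrt (by positivity), div_lt_one (by positivity)]
    exact hminy
  rw [Real.sqrt_mul hσhh.le, eq_div_iff (by positivity)] at hρhx hρhy
  rw [Real.sqrt_mul hσxx.le, eq_div_iff (by positivity)] at hρxy
  have hp : 0 < √σhh := Real.sqrt_pos.2 hσhh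
  have hq : 0 < √σxx := Real.sqrt_pos.2 hσxx
  have hr : 0 < √σyy := Real.sqrt_pos.2 hσyy
  have hpp := Real.sq_sqrt hσhh.le
  have hqq := Real.sq_sqrt hσxx.le
  have hrr := Real.sq_sqrt hσyy.le
  generalize √σhh = p at *
  generalize √σxx = q at *
  generalize √σyy = r at *
  subst hρhx hρhy hρxy hpp hqq hrr
  have hab : ρhx * ρhy ≠ 0 :=
    mul_ne_zero (left_ne_zero_of_mul hhx) (left_ne_zero_of_mul hhy)
  have hcovx : γ * p = -((s_x + s_h) * ρhx * q) :=
    mul_left_cancel₀ hp.ne' (by linear_combination ehx)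
  have hcovy : δ * p = -((s_y + s_h) * ρhy * r) :=
    mul_left_cancel₀ hp.ne' (by linear_combination ehy)
  have key : (s_x + s_y) * (ρxy - ρhx * ρhy) = 2 * ρhx * ρhy * s_h :=
    mul_left_cancel₀ (mul_pos hq hr).ne'
      (by linear_combination exy - ρhy * r * hcovx - ρhx * q * hcovy)
  have hne : ρxy - ρhx * ρhy ≠ 0 := fun h => by
    rw [h, mul_zero] at key
    exact mul_ne_zero hab hsh.ne (by linarith)
  have hx := correlation_odds_lt_of_lyapunov hsh hq hρhx_lt hdx hcovx
    (by linear_combination exx)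
  have hy := correlation_odds_lt_of_lyapunov hsh hr hρhy_lt hdy hcovy
    (by linear_combination eyy)
  refine ⟨sub_ne_zero.1 hne, ?_⟩
  have hratio : 2 * ρhx * ρhy / (ρxy - ρhx * ρhy) = s_x / s_h + s_y / s_h := by
    rw [← add_div, div_eq_div_iff hne hsh.ne, key]
  linarith
end

section
/- Let Σ = (σ_hh, σ_hx, σ_hy; σ_hx, σ_xx, σ_xy; σ_hy, σ_xy, σ_yy) be a symmetric positive definite real 3×3 matrix with σ_hx ≠ 0, σ_hy ≠ 0, σ_xy ≠ 0. Define the correlations ρ_hx = σ_hx/√(σ_hh·σ_xx), ρ_hy = σ_hy/√(σ_hh·σ_yy), ρ_xy = σ_xy/√(σ_xx·σ_yy). Assume ρ_xy ≠ ρ_hx·ρ_hy and 2·ρ_hx·ρ_hy/(ρ_xy − ρ_hx·ρ_hy) > ρ_hx²/(1 − ρ_hx²) + ρ_hy²/(1 − ρ_hy²). Then there exist real numbers s_h, s_x, s_y, γ, δ and d_h, d_x, d_y > 0 such that, with A the 3×3 matrix with rows (s_h, 0, 0), (γ, s_x, 0), (δ, 0, s_y) and D = diag(d_h, d_x, d_y),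 the Lyapunov equation AΣ + ΣAᵀ = −D holds. -/
open Matrix

/-- A principal `2 × 2` minor of a real positive definite matrix is positive. -/
theorem Matrix.PosDef.sq_lt_mul_diag {n : Type*} [Fintype n] {S : Matrix n n ℝ}
    (hS : S.PosDef) {i j : n} (hij : i ≠ j) : S i j ^ 2 < S i i * S j j := by
  have hinj : Function.Injective ![i, j] := by
    intro k l hkl
    fin_cases k <;> fin_cases l <;> simp_all [eq_comm]
  have hdet := (hS.submatrix hinj).det_pos
  have hsymm : S j i = S i j := by simpa using hS.isHermitian.apply i j
  simp only [det_fin_two, submatrix_apply, cons_val_zero, cons_val_one, hsymm] at hdet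
  linarith [sq (S i j)]

/-- The ratio `r² / (1 - r²)` of a correlation `r`, in terms of covariances. -/
theorem sq_correlation_div_one_sub {a b d : ℝ} (had : 0 < a * d) :
    (b / √(a * d)) ^ 2 / (1 - (b / √(a * d)) ^ 2) = b ^ 2 / (a * d - b ^ 2) := by
  rw [div_pow, Real.sq_sqrt had.le, one_sub_div had.ne', div_div_div_cancel_right₀ had.ne']

theorem stmt_15 (σhh σhx σhy σxx σxy σyy : ℝ)
    (S : Matrix (Fin 3) (Fin 3) ℝ)
    (hS : S = !![σhh, σhx, σhy; σhx, σxx, σxy; σhy, σxy, σyy])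
    (hpd : S.PosDef)
    (hhx : σhx ≠ 0) (hhy : σhy ≠ 0) (hxy : σxy ≠ 0)
    (ρhx ρhy ρxy : ℝ)
    (hρhx : ρhx = σhx / Real.sqrt (σhh * σxx))
    (hρhy : ρhy = σhy / Real.sqrt (σhh * σyy))
    (hρxy : ρxy = σxy / Real.sqrt (σxx * σyy))
    (hne : ρxy ≠ ρhx * ρhy)
    (hineq : ρhx ^ 2 / (1 - ρhx ^ 2) + ρhy ^ 2 / (1 - ρhy ^ 2) <
      2 * ρhx * ρhy / (ρxy - ρhx * ρhy)) :
    ∃ s_h s_x s_y γ δ d_h d_x d_y : ℝ, 0 < d_h ∧ 0 < d_x ∧ 0 < d_y ∧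
      !![s_h, 0, 0; γ, s_x, 0; δ, 0, s_y] * S +
        S * (!![s_h, 0, 0; γ, s_x, 0; δ, 0, s_y])ᵀ =
          -(Matrix.diagonal ![d_h, d_x, d_y]) := by
  subst hS hρhx hρhy hρxy
  have ha : 0 < σhh := by simpa using hpd.diag_pos (i := 0)
  have hd : 0 < σxx := by simpa using hpd.diag_pos (i := 1)
  have hf : 0 < σyy := by simpa using hpd.diag_pos (i := 2)
  have hx : σhx ^ 2 < σhh * σxx := by
    simpa using hpd.sq_lt_mul_diag (i := 0) (j := 1) (by decide)
  have hy : σhy ^ 2 < σhh * σyy := by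
    simpa using hpd.sq_lt_mul_diag (i := 0) (j := 2) (by decide)
  have hprod : σhx / √(σhh * σxx) * (σhy / √(σhh * σyy)) =
      σhx * σhy / (σhh * √(σxx * σyy)) := by
    rw [Real.sqrt_mul ha.le, Real.sqrt_mul ha.le, Real.sqrt_mul hd.le, div_mul_div_comm]
    congr 1
    linear_combination √σxx * √σyy * Real.mul_self_sqrt ha.le
  have hw : 0 < √(σxx * σyy) := by positivity
  have hsub : σxy / √(σxx * σyy) - σhx * σhy / (σhh * √(σxx * σyy)) =
      (σhh * σxy - σhx * σhy) / (σhh * √(σxx * σyy)) := by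
    field_simp
  rw [hprod, ← sub_ne_zero, hsub] at hne
  have hm : σhh * σxy - σhx * σhy ≠ 0 := (div_ne_zero_iff.mp hne).1
  rw [sq_correlation_div_one_sub (by positivity), sq_correlation_div_one_sub (by positivity),
    mul_assoc, hprod, hsub, ← mul_div_assoc, div_div_div_cancel_right₀ (by positivity)] at hineq
  have hp : σhx ^ 2 / (σhh * σxx - σhx ^ 2) * (σhh * σxx - σhx ^ 2) = σhx ^ 2 :=
    div_mul_cancel₀ _ (sub_pos.mpr hx).ne'
  have hq : σhy ^ 2 / (σhh * σyy - σhy ^ 2) * (σhh * σyy - σhy ^ 2) = σhy ^ 2 :=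
    div_mul_cancel₀ _ (sub_pos.mpr hy).ne'
  have ht : 2 * (σhx * σhy) / (σhh * σxy - σhx * σhy) * (σhh * σxy - σhx * σhy) =
      2 * (σhx * σhy) := div_mul_cancel₀ _ hm
  generalize σhx ^ 2 / (σhh * σxx - σhx ^ 2) = p at *
  generalize σhy ^ 2 / (σhh * σyy - σhy ^ 2) = q at *
  generalize 2 * (σhx * σhy) / (σhh * σxy - σhx * σhy) = t at *
  obtain ⟨k, hk⟩ : ∃ k, k = (t - p - q) / 2 := ⟨_, rfl⟩
  have hkpos : 0 < k := by linarith
  obtain rfl : t = p + q + 2 * k := by linarith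
  -- With `s_h = -1`, the `(h,x)` and `(h,y)` entries determine `γ` and `δ`, the `(x,y)` entry
  -- forces `s_x + s_y = -t`, and `d_x, d_y > 0` amounts to `s_x < -p` and `s_y < -q`.
  refine ⟨-1, -(p + k), -(q + k), (1 + p + k) * σhx / σhh, (1 + q + k) * σhy / σhh,
    2 * σhh, 2 * k * (σhh * σxx - σhx ^ 2) / σhh, 2 * k * (σhh * σyy - σhy ^ 2) / σhh,
    by positivity, div_pos (mul_pos (by positivity) (sub_pos.mpr hx)) ha,
    div_pos (mul_pos (by positivity) (sub_pos.mpr hy)) ha, ?_⟩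
  ext i j
  fin_cases i <;> fin_cases j <;>
    simp [Matrix.diagonal, vecMul, dotProduct, Fin.sum_univ_three] <;> field_simp
  all_goals first
    | ring1
    | linear_combination -2 * hp
    | linear_combination -2 * hq
    | linear_combination -ht
end

section
/- Let Σ = (σ_hh, σ_hx, σ_hy; σ_hx, σ_xx, σ_xy; σ_hy, σ_xy, σ_yy) be a symmetric positive definite real 3×3 matrix with σ_hx ≠ 0, σ_hy ≠ 0, σ_xy ≠ 0. Then there exist real numbers s_h, s_x, s_y, γ, δ, α, all nonzero, and d_h, d_x, d_y > 0 such that, with A the 3×3 matrix with rows (s_h, 0, 0), (γ, s_x, 0), (δ, α, s_y) and D = diag(d_h, d_x, d_y), the Lyapunov equation AΣ + ΣAᵀ = −D holds. -/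
open Matrix

/-- A nonzero affine function of one real variable does not vanish beyond some point. -/
theorem exists_forall_gt_affine_ne_zero (m n : ℝ) (h : m = 0 → n ≠ 0) :
    ∃ M : ℝ, ∀ r > M, r * m + n ≠ 0 := by
  by_cases hm : m = 0
  · exact ⟨0, fun r _ => by simpa [hm] using h hm⟩
  · refine ⟨-n / m, fun r hr h0 => hr.ne ?_⟩
    rw [div_eq_iff hm]
    linarith

theorem stmt_16 (σhh σhx σhy σxx σxy σyy : ℝ)
    (S : Matrix (Fin 3) (Fin 3) ℝ)
    (hS : S = !![σhh, σhx, σhy; σhx, σxx, σxy; σhy, σxy, σyy])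
    (hpd : S.PosDef)
    (hhx : σhx ≠ 0) (hhy : σhy ≠ 0) (hxy : σxy ≠ 0) :
    ∃ s_h s_x s_y γ δ α d_h d_x d_y : ℝ,
      s_h ≠ 0 ∧ s_x ≠ 0 ∧ s_y ≠ 0 ∧ γ ≠ 0 ∧ δ ≠ 0 ∧ α ≠ 0 ∧
      0 < d_h ∧ 0 < d_x ∧ 0 < d_y ∧
      !![s_h, 0, 0; γ, s_x, 0; δ, α, s_y] * S +
        S * (!![s_h, 0, 0; γ, s_x, 0; δ, α, s_y])ᵀ =
          -(Matrix.diagonal ![d_h, d_x, d_y]) := by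
  have ha : 0 < σhh := by simpa [hS] using hpd.diag_pos (i := 0)
  have he : 0 < σxx := by simpa [hS] using hpd.diag_pos (i := 1)
  have hΔ : 0 < σhh * σxx - σhx * σhx := by
    have h := (hpd.submatrix (e := ![(0 : Fin 3), 1]) (by decide)).det_pos
    rw [Matrix.det_fin_two] at h
    simpa [hS] using h
  have hdet := hpd.det_pos
  rw [hS, Matrix.det_fin_three] at hdet
  simp only [of_apply, cons_val', cons_val_zero, cons_val_one, cons_val] at hdet
  rw [hS]
  clear hpd hS S
  generalize σhh = a at *
  generalize σhx = b at *
  generalize σhy = c at *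
  generalize σxx = e at *
  generalize σxy = f at *
  generalize σyy = g at *
  obtain ⟨p, hp⟩ : ∃ p, p = a * e - b * b := ⟨_, rfl⟩
  rw [← hp] at hΔ
  obtain ⟨q, hq⟩ : ∃ q, q = 2 * (a * e) := ⟨_, rfl⟩
  have hae : 0 < a * e := mul_pos ha he
  have hq0 : 0 < q := by rw [hq]; positivity
  obtain ⟨t, ht⟩ : ∃ t, t = q * (a * f - b * c) - 2 * p * b * c := ⟨_, rfl⟩
  obtain ⟨u, hu⟩ : ∃ u, u = p * c * (e + b ^ 2 / a) + q * (b ^ 2 * c / a - b * f) := ⟨_, rfl⟩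
  -- The numerators of `α` and `δ` are affine in `r = -s_y`.
  obtain ⟨M, hM⟩ := exists_forall_gt_affine_ne_zero (a * f - b * c) t (fun h => by
    rw [ht, h, mul_zero, zero_sub, neg_ne_zero]
    positivity)
  obtain ⟨N, hN⟩ := exists_forall_gt_affine_ne_zero (e * c - b * f) u (fun h hu0 => by
    have hc : c = b * f / e := by field_simp; linarith
    have : u = - (p * b * f * p / (a * e)) := by
      rw [hu, hc, hq, hp]; field_simp; ring
    rw [hu0, zero_eq_neg] at this
    have h' : p * b * f * p / (a * e) ≠ 0 := by positivity
    exact h' this)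
  obtain ⟨d, hd⟩ : ∃ d, d = a * e * g - a * f * f - b * b * g + b * f * c + c * b * f - c * e * c :=
    ⟨_, rfl⟩
  rw [← hd] at hdet
  obtain ⟨r, hr⟩ := exists_gt (max (max M N) (max 0 ((c * u + f * t) / d)))
  simp only [max_lt_iff] at hr
  obtain ⟨⟨hrM, hrN⟩, hr0, hrd⟩ := hr
  rw [div_lt_iff₀ hdet] at hrd
  refine ⟨-p, -q, -r, (p + q) * b / a, (r * (e * c - b * f) + u) / p,
    (r * (a * f - b * c) + t) / p, 2 * p * a, 2 * p * (q - b ^ 2) / a,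
    2 * (r * d - (c * u + f * t)) / p, neg_ne_zero.2 hΔ.ne', neg_ne_zero.2 hq0.ne',
    neg_ne_zero.2 hr0.ne', ?_, div_ne_zero (hN r hrN) hΔ.ne', div_ne_zero (hM r hrM) hΔ.ne',
    by positivity, ?_, div_pos (by linarith) hΔ, ?_⟩
  · have : 0 < p + q := by positivity
    positivity
  · have : 0 < q - b ^ 2 := by nlinarith
    positivity
  · have hp' := hΔ.ne'
    have ha' := ha.ne'
    ext i j
    fin_cases i <;> fin_cases j <;>
      simp [Matrix.vecMul, dotProduct, Fin.sum_univ_three] <;>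
      (try rw [hd]) <;> (try rw [hu]) <;> (try rw [ht]) <;> field_simp <;>
      (try rw [hq]) <;> (try rw [hp]) <;> ring
end

section
/- For every real number v > 0 the following two claims both hold. (1) There exist real numbers σ_hh, σ_hy, s_h, s_y, α, d_h, d_y with: the 2×2 matrix Σ with rows (σ_hh, σ_hy), (σ_hy, v) positive definite, σ_hy ≠ 0, s_h < 0, s_y < 0, d_h > 0, d_y > 0, α > 0, and AΣ + ΣAᵀ = −D where A has rows (s_h, 0), (α, s_y) and D = diag(d_h, d_y). (2) The same with α < 0 instead of α > 0. -/
open Matrix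

/-- A real symmetric `2 × 2` matrix with positive leading principal minors is positive definite. -/
theorem posDef_fin_two_of_minors_pos {a b c : ℝ} (ha : 0 < a) (hdet : 0 < a * c - b ^ 2) :
    (!![a, b; b, c]).PosDef := by
  refine Matrix.PosDef.of_dotProduct_mulVec_pos ?_ fun x hx => ?_
  · ext i j
    fin_cases i <;> fin_cases j <;> simp
  · have hform : star x ⬝ᵥ (!![a, b; b, c] *ᵥ x) =
        ((a * x 0 + b * x 1) ^ 2 + (a * c - b ^ 2) * x 1 ^ 2) / a := by
      simp [dotProduct, mulVec, Fin.sum_univ_two]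
      field_simp
      ring
    rw [hform]
    refine div_pos ?_ ha
    by_cases h1 : x 1 = 0
    · have h0 : x 0 ≠ 0 := fun h0 => hx (by ext i; fin_cases i <;> simp [h0, h1])
      simp [h1, h0, ha.ne', sq_pos_iff]
    · positivity

/-- Unit self-loops and causal effect `ε = ±1` realise any prescribed effect variance `v`. -/
theorem lyapunov_of_sq_eq_one {v ε : ℝ} (hv : 0 < v) (hε : ε ^ 2 = 1) :
    (!![v, ε * v / 2; ε * v / 2, v]).PosDef ∧ ε * v / 2 ≠ 0 ∧
      !![-1, 0; ε, -1] * !![v, ε * v / 2; ε * v / 2, v] +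
        !![v, ε * v / 2; ε * v / 2, v] * (!![-1, 0; ε, -1])ᵀ =
          -(Matrix.diagonal ![2 * v, v]) := by
  have hε0 : ε ≠ 0 := by
    rintro rfl
    norm_num at hε
  refine ⟨posDef_fin_two_of_minors_pos hv ?_, by positivity, ?_⟩
  · have : v * v - (ε * v / 2) ^ 2 = 3 / 4 * v ^ 2 := by linear_combination -(v ^ 2 / 4) * hε
    rw [this]
    positivity
  · ext i j
    fin_cases i <;> fin_cases j <;> simp [vecMul, dotProduct]
    · ring
    · ring
    · ring
    · linear_combination v * hε

theorem stmt_17 (v : ℝ) (hv : 0 < v) :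
    (∃ σhh σhy s_h s_y α d_h d_y : ℝ,
      (!![σhh, σhy; σhy, v]).PosDef ∧ σhy ≠ 0 ∧ s_h < 0 ∧ s_y < 0 ∧
      0 < d_h ∧ 0 < d_y ∧ 0 < α ∧
      !![s_h, 0; α, s_y] * !![σhh, σhy; σhy, v] +
        !![σhh, σhy; σhy, v] * (!![s_h, 0; α, s_y])ᵀ =
          -(Matrix.diagonal ![d_h, d_y])) ∧
    (∃ σhh σhy s_h s_y α d_h d_y : ℝ,
      (!![σhh, σhy; σhy, v]).PosDef ∧ σhy ≠ 0 ∧ s_h < 0 ∧ s_y < 0 ∧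
      0 < d_h ∧ 0 < d_y ∧ α < 0 ∧
      !![s_h, 0; α, s_y] * !![σhh, σhy; σhy, v] +
        !![σhh, σhy; σhy, v] * (!![s_h, 0; α, s_y])ᵀ =
          -(Matrix.diagonal ![d_h, d_y])) := by
  obtain ⟨hpos, hne, hlyap⟩ := lyapunov_of_sq_eq_one (ε := 1) hv (by norm_num)
  obtain ⟨hpos', hne', hlyap'⟩ := lyapunov_of_sq_eq_one (ε := -1) hv (by norm_num)
  exact ⟨⟨_, _, -1, -1, 1, 2 * v, v, hpos, hne, by norm_num, by norm_num, by positivity, hv,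
      by norm_num, hlyap⟩,
    ⟨_, _, -1, -1, -1, 2 * v, v, hpos', hne', by norm_num, by norm_num, by positivity, hv,
      by norm_num, hlyap'⟩⟩
end

section
/- Let σ_xx, σ_xy, σ_yy be real numbers such that the 2×2 matrix with rows (σ_xx, σ_xy), (σ_xy, σ_yy) is positive definite and σ_xy ≠ 0. Then there exist real numbers σ_hh, σ_hx, σ_hy with σ_hx ≠ 0 and σ_hy ≠ 0 such that the 3×3 matrix Σ = (σ_hh, σ_hx, σ_hy; σ_hx, σ_xx, σ_xy; σ_hy, σ_xy, σ_yy) is positive definite, and such that both of the following hold for this single Σ: (a) there exist nonzero reals s_h, s_x, s_y, γ, δ, α with α > 0 and d_h, d_x, d_y > 0 with AΣ + ΣAᵀ = −D, where A has rows (s_h, 0, 0), (γ, s_x, 0), (δ, α, s_y) and D = diag(d_h, d_x, d_y); and (b) the same with α < 0. -/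
open Matrix

/-- A latent extension of the covariance block with entries `a`, `r * a * k`, `a * k ^ 2`. -/
def latentExtension (a r k : ℝ) : Matrix (Fin 3) (Fin 3) ℝ :=
  !![2 * r * a, r * a, r * a * k; r * a, a, r * a * k; r * a * k, r * a * k, a * k ^ 2]

theorem latentExtension_posDef {a r k : ℝ} (ha : 0 < a) (hr : 0 < r) (hr1 : r < 1) (hk : k ≠ 0) :
    (latentExtension a r k).PosDef := by
  refine Matrix.PosDef.of_dotProduct_mulVec_pos ?_ fun x hx => ?_
  · ext i j
    fin_cases i <;> fin_cases j <;> simp [latentExtension]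
  · have hform : star x ⬝ᵥ (latentExtension a r k *ᵥ x) =
        2 * r * a * (x 0 + (x 1 + k * x 2) / 2) ^ 2 + a * (1 - r) * (x 1 ^ 2 + (k * x 2) ^ 2) +
          r * a / 2 * (x 1 + k * x 2) ^ 2 := by
      simp [latentExtension, dotProduct, Matrix.mulVec, Fin.sum_univ_three]
      ring
    rw [hform]
    have hr1' : 0 < 1 - r := sub_pos.2 hr1
    by_cases h1 : x 1 = 0
    · by_cases h2 : x 2 = 0
      · have h0 : x 0 ≠ 0 := fun h0 => hx (by ext i; fin_cases i <;> simp [h0, h1, h2])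
        simp only [h1, h2]
        ring_nf
        positivity
      · positivity
    · positivity

/-- A drift matrix solving the Lyapunov equation for `latentExtension a r k`, with decay rate `u`
of the latent coordinate and unit decay rates of the observed ones. -/
theorem exists_drift_latentExtension {a r k u : ℝ} (ha : 0 < a) (hr : 0 < r) (hr1 : r < 1)
    (hk : k ≠ 0) (hu : 0 < u) (hx : (u + 1) * r < 2)
    (hδ : 2 * r * (1 - u) < (u + 1) * (2 - r))
    (hy : 2 * r ^ 2 * (1 - u) < (2 - r * (u + 1)) * (2 - r)) :
    ∃ s_h s_x s_y γ δ d_h d_x d_y : ℝ,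
      s_h ≠ 0 ∧ s_x ≠ 0 ∧ s_y ≠ 0 ∧ γ ≠ 0 ∧ δ ≠ 0 ∧ 0 < d_h ∧ 0 < d_x ∧ 0 < d_y ∧
      !![s_h, 0, 0; γ, s_x, 0; δ, 2 * r * k * (1 - u) / (2 - r), s_y] * latentExtension a r k +
        latentExtension a r k * (!![s_h, 0, 0; γ, s_x, 0; δ, 2 * r * k * (1 - u) / (2 - r), s_y])ᵀ =
          -(Matrix.diagonal ![d_h, d_x, d_y]) := by
  have h2 : 0 < 2 - r := by linarith
  have hδ' : 0 < (u + 1) * (2 - r) - 2 * r * (1 - u) := sub_pos.2 hδ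
  have hx' : 0 < 2 - (u + 1) * r := sub_pos.2 hx
  have hy' : 0 < (2 - r * (u + 1)) * (2 - r) - 2 * r ^ 2 * (1 - u) := sub_pos.2 hy
  refine ⟨-u, -1, -1, (u + 1) / 2, k * ((u + 1) * (2 - r) - 2 * r * (1 - u)) / (2 * (2 - r)),
    4 * u * r * a, a * (2 - (u + 1) * r),
    a * k ^ 2 * ((2 - r * (u + 1)) * (2 - r) - 2 * r ^ 2 * (1 - u)) / (2 - r),
    by simpa using hu.ne', by norm_num, by norm_num, by positivity, by positivity, by positivity,
    by positivity, by positivity, ?_⟩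
  ext i j
  fin_cases i <;> fin_cases j <;>
    simp [latentExtension, Matrix.vecMul, dotProduct, Fin.sum_univ_three] <;> field_simp <;> ring

/-- The observed block in terms of the correlation `r`, up to sign, and a scale ratio `k`. -/
theorem exists_scale_of_posDef {a b c : ℝ} (h : (!![a, b; b, c]).PosDef) (hb : b ≠ 0) :
    0 < a ∧ ∃ r k : ℝ, 0 < r ∧ r < 1 ∧ k ≠ 0 ∧ b = r * a * k ∧ c = a * k ^ 2 := by
  have ha : 0 < a := by simpa using h.diag_pos (i := 0)
  have hc : 0 < c := by simpa using h.diag_pos (i := 1)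
  have hdet : b ^ 2 < a * c := by
    have := h.det_pos
    rw [Matrix.det_fin_two_of] at this
    nlinarith
  have hac : 0 < a * c := mul_pos ha hc
  set s := √(a * c)
  have hs0 : 0 < s := Real.sqrt_pos.2 hac
  have hs2 : s ^ 2 = a * c := Real.sq_sqrt hac.le
  have hb0 : 0 < |b| := abs_pos.2 hb
  have hbs : |b| < s := abs_lt_of_sq_lt_sq (by rwa [hs2]) hs0.le
  have hbb : |b| ^ 2 = b ^ 2 := sq_abs b
  refine ⟨ha, |b| / s, b * s / (|b| * a), by positivity, (div_lt_one hs0).2 hbs, by positivity,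
    by field_simp, ?_⟩
  rw [div_pow, mul_pow, mul_pow, hs2, hbb]
  field_simp

theorem stmt_18 (σxx σxy σyy : ℝ)
    (hpd2 : (!![σxx, σxy; σxy, σyy]).PosDef) (hxy : σxy ≠ 0) :
    ∃ σhh σhx σhy : ℝ, σhx ≠ 0 ∧ σhy ≠ 0 ∧
      (!![σhh, σhx, σhy; σhx, σxx, σxy; σhy, σxy, σyy]).PosDef ∧
      (∃ s_h s_x s_y γ δ α d_h d_x d_y : ℝ,
        s_h ≠ 0 ∧ s_x ≠ 0 ∧ s_y ≠ 0 ∧ γ ≠ 0 ∧ δ ≠ 0 ∧ 0 < α ∧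
        0 < d_h ∧ 0 < d_x ∧ 0 < d_y ∧
        !![s_h, 0, 0; γ, s_x, 0; δ, α, s_y] *
            !![σhh, σhx, σhy; σhx, σxx, σxy; σhy, σxy, σyy] +
          !![σhh, σhx, σhy; σhx, σxx, σxy; σhy, σxy, σyy] *
            (!![s_h, 0, 0; γ, s_x, 0; δ, α, s_y])ᵀ =
              -(Matrix.diagonal ![d_h, d_x, d_y])) ∧
      (∃ s_h s_x s_y γ δ α d_h d_x d_y : ℝ,
        s_h ≠ 0 ∧ s_x ≠ 0 ∧ s_y ≠ 0 ∧ γ ≠ 0 ∧ δ ≠ 0 ∧ α < 0 ∧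
        0 < d_h ∧ 0 < d_x ∧ 0 < d_y ∧
        !![s_h, 0, 0; γ, s_x, 0; δ, α, s_y] *
            !![σhh, σhx, σhy; σhx, σxx, σxy; σhy, σxy, σyy] +
          !![σhh, σhx, σhy; σhx, σxx, σxy; σhy, σxy, σyy] *
            (!![s_h, 0, 0; γ, s_x, 0; δ, α, s_y])ᵀ =
              -(Matrix.diagonal ![d_h, d_x, d_y])) := by
  obtain ⟨ha, r, k, hr, hr1, hk, rfl, rfl⟩ := exists_scale_of_posDef hpd2 hxy
  have hr1' : 0 < 1 - r := sub_pos.2 hr1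
  have h2 : 0 < 2 - r := by linarith
  have hq : 0 < (1 - r) * r := mul_pos hr1' hr
  refine ⟨2 * r * σxx, r * σxx, r * σxx * k, by positivity, hxy,
    latentExtension_posDef ha hr hr1 hk, ?_⟩
  obtain ⟨s_h, s_x, s_y, γ, δ, d_h, d_x, d_y, h₁, h₂, h₃, h₄, h₅, h₆, h₇, h₈, h₉⟩ :=
    exists_drift_latentExtension (u := r) ha hr hr1 hk hr (by nlinarith) (by nlinarith)
      (by nlinarith [mul_pos hr1' (show 0 < 4 - 3 * r ^ 2 by nlinarith)])
  obtain ⟨t_h, t_x, t_y, γ', δ', e_h, e_x, e_y, g₁, g₂, g₃, g₄, g₅, g₆, g₇, g₈, g₉⟩ :=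
    exists_drift_latentExtension (u := 2 - r) ha hr hr1 hk h2 (by nlinarith) (by nlinarith)
      (by nlinarith [mul_pos hr1' (show 0 < (2 - r) ^ 2 + 2 * r ^ 2 by positivity)])
  have hneg : 2 * r * k * (1 - (2 - r)) / (2 - r) = -(2 * r * k * (1 - r) / (2 - r)) := by ring
  rcases hk.lt_or_gt with hk | hk
  · have hα : 0 < 2 * r * (-k) * (1 - r) / (2 - r) := by
      have := neg_pos.2 hk
      positivity
    have hα' : 2 * r * k * (1 - r) / (2 - r) = -(2 * r * (-k) * (1 - r) / (2 - r)) := by ring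
    exact ⟨⟨t_h, t_x, t_y, γ', δ', _, e_h, e_x, e_y, g₁, g₂, g₃, g₄, g₅, by linarith,
        g₆, g₇, g₈, g₉⟩,
      ⟨s_h, s_x, s_y, γ, δ, _, d_h, d_x, d_y, h₁, h₂, h₃, h₄, h₅, by linarith, h₆, h₇, h₈, h₉⟩⟩
  · have hα : 0 < 2 * r * k * (1 - r) / (2 - r) := by positivity
    exact ⟨⟨s_h, s_x, s_y, γ, δ, _, d_h, d_x, d_y, h₁, h₂, h₃, h₄, h₅, hα, h₆, h₇, h₈, h₉⟩,
      ⟨t_h, t_x, t_y, γ', δ', _, e_h, e_x, e_y, g₁, g₂, g₃, g₄, g₅, by linarith,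
        g₆, g₇, g₈, g₉⟩⟩
end

section
/- Let s_x, s_h, s_y, β, γ and the entries of a symmetric 3×3 matrix Σ = (σ_xx, σ_xh, σ_xy; σ_xh, σ_hh, σ_hy; σ_xy, σ_hy, σ_yy) and d_x, d_h, d_y > 0 be real numbers. Let A be the 3×3 matrix with rows (s_x, 0, γ), (β, s_h, 0), (0, 0, s_y) (note the (3,2) entry, the edge H → Y, is zero) and let D = diag(d_x, d_h, d_y). Assume Σ is positive definite, AΣ + ΣAᵀ = −D, and σ_xy ≠ 0. Then σ_xh·σ_hy ≠ σ_hh·σ_xy. -/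
open Matrix

theorem stmt_19 (s_x s_h s_y β γ σxx σxh σxy σhh σhy σyy d_x d_h d_y : ℝ)
    (hdx : 0 < d_x) (hdh : 0 < d_h) (hdy : 0 < d_y)
    (A S D : Matrix (Fin 3) (Fin 3) ℝ)
    (hA : A = !![s_x, 0, γ; β, s_h, 0; 0, 0, s_y])
    (hS : S = !![σxx, σxh, σxy; σxh, σhh, σhy; σxy, σhy, σyy])
    (hD : D = Matrix.diagonal ![d_x, d_h, d_y])
    (hpd : S.PosDef)
    (hlyap : A * S + S * Aᵀ = -D)
    (hxy : σxy ≠ 0) :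
    σxh * σhy ≠ σhh * σxy := by
  subst hA hS hD
  intro hratio
  have hhh_pos : 0 < σhh := by simpa using hpd.diag_pos (i := 1)
  have hyy_pos : 0 < σyy := by simpa using hpd.diag_pos (i := 2)
  have hhh := congrFun (congrFun hlyap 1) 1
  have hhy := congrFun (congrFun hlyap 1) 2
  have hyy := congrFun (congrFun hlyap 2) 2
  simp [Matrix.vecMul, dotProduct, Fin.sum_univ_three] at hhh hhy hyy
  have hsy : s_y < 0 := by
    by_contra! h
    nlinarith [mul_nonneg h hyy_pos.le]
  have hβ : β * σxh = -(s_h + s_y) * σhh :=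
    mul_right_cancel₀ hxy (by linear_combination σxh * hhy - (s_h + s_y) * hratio)
  nlinarith [mul_neg_of_neg_of_pos hsy hhh_pos]
end
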